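/- Fix an integer d ≥ 2. The function H has the limits H(z) → d + 1 as z → 0⁺ and H(z) → d/2 + 1 as z → ∞; equivalently, c_p/k_B tends to d/2 + 1 as the temperature T → 0 and to d + 1 as T → ∞. -/

import Mathlib

open MeasureTheory Real Filter

/-- The modified Bessel function of the second kind, defined via its integral
representation `K_ν(z) = ∫_0^∞ exp(−z cosh t) cosh(ν t) dt`. -/
noncomputable def besselK (ν z : ℝ) : ℝ :=
  ∫ t in Set.Ioi (0:ℝ), Real.exp (-z * Real.cosh t) * Real.cosh (ν * t)

/-- The ratio `G_k(z) = K_{(d+1)/2+k}(z) / K_{(d+1)/2}(z)`. -/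
noncomputable def G (d k : ℤ) (z : ℝ) : ℝ :=
  besselK (((d : ℝ) + 1) / 2 + (k : ℝ)) z / besselK (((d : ℝ) + 1) / 2) z

/-- `H(z) = −z² G_1′(z)`; physically `H(z) = c_p/k_B` is the dimensionless heat
capacity per particle at constant pressure, and `H(z) − 1 = c_v/k_B`. -/
noncomputable def Hfun (d : ℤ) (z : ℝ) : ℝ := -z ^ 2 * deriv (G d 1) z

theorem cosh_sub_one_eq (t : ℝ) : Real.cosh t - 1 = 2 * Real.sinh (t / 2) ^ 2 := by
  have := Real.cosh_two_mul (t / 2)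
  rw [Real.cosh_sq, show 2 * (t / 2) = t by ring] at this
  linarith

theorem sq_div_two_le_cosh_sub_one (t : ℝ) : t ^ 2 / 2 ≤ Real.cosh t - 1 := by
  wlog ht : 0 ≤ t generalizing t
  · simpa using this (-t) (by linarith)
  have h1 : t / 2 ≤ Real.sinh (t / 2) := Real.self_le_sinh_iff.2 (by linarith)
  rw [cosh_sub_one_eq]
  nlinarith

theorem sinh_le_self_mul_exp (x : ℝ) : Real.sinh x ≤ x * Real.exp x := by
  have h1 := Real.add_one_le_exp (-(2 * x))
  have h2 : Real.exp (-x) = Real.exp x * Real.exp (-(2 * x)) := by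
    rw [← Real.exp_add]; ring_nf
  rw [Real.sinh_eq, h2]
  nlinarith [Real.exp_pos x]

theorem cosh_le_exp_abs (x : ℝ) : Real.cosh x ≤ Real.exp |x| := by
  rw [← Real.cosh_abs, ← Real.cosh_add_sinh]
  linarith [Real.sinh_nonneg_iff.2 (abs_nonneg x)]

theorem tendsto_sinh_mul_div (a : ℝ) :
    Tendsto (fun t : ℝ => Real.sinh (a * t) / t) (nhdsWithin 0 (Set.Ioi 0)) (nhds a) := by
  have h : HasDerivAt (fun t : ℝ => Real.sinh (a * t)) a 0 := by
    simpa using ((hasDerivAt_id (0 : ℝ)).const_mul a).sinh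
  have h2 := h.tendsto_slope_zero_right
  simpa [div_eq_inv_mul] using h2

theorem exp_neg_mul_cosh_mul_cosh_le {z : ℝ} (hz : 0 < z) (μ : ℝ) {t : ℝ} (ht : 0 ≤ t) :
    Real.exp (-z * Real.cosh t) * Real.cosh (μ * t) ≤
      Real.exp ((|μ| + 1) ^ 2 / (2 * z)) * Real.exp (-1 * t) := by
  have h1 := sq_div_two_le_cosh_sub_one t
  calc _ ≤ Real.exp (-z * Real.cosh t) * Real.exp (|μ| * t) := by
        gcongr
        simpa [abs_mul, abs_of_nonneg ht] using cosh_le_exp_abs (μ * t)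
    _ ≤ _ := by
        rw [← Real.exp_add, ← Real.exp_add]
        apply Real.exp_le_exp.2
        have h3 : z * (t ^ 2 / 2) ≤ z * Real.cosh t := by gcongr; linarith
        have h4 : (|μ| + 1) * t ≤ (|μ| + 1) ^ 2 / (2 * z) + z * (t ^ 2 / 2) := by
          have : (|μ| + 1) ^ 2 / (2 * z) + z * (t ^ 2 / 2) - (|μ| + 1) * t
              = (|μ| + 1 - z * t) ^ 2 / (2 * z) := by field_simp; ring
          have h5 : 0 ≤ (|μ| + 1 - z * t) ^ 2 / (2 * z) := by positivity
          linarith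
        linarith

theorem integrableOn_besselK {z : ℝ} (hz : 0 < z) (μ : ℝ) :
    IntegrableOn (fun t => Real.exp (-z * Real.cosh t) * Real.cosh (μ * t)) (Set.Ioi 0) := by
  refine Integrable.mono' ((exp_neg_integrableOn_Ioi 0 one_pos).const_mul
    (Real.exp ((|μ| + 1) ^ 2 / (2 * z)))) (by fun_prop) ?_
  refine (ae_restrict_iff' measurableSet_Ioi).2 (ae_of_all _ fun t ht => ?_)
  rw [Real.norm_of_nonneg (by positivity)]
  exact exp_neg_mul_cosh_mul_cosh_le hz μ (le_of_lt ht)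

theorem cosh_mul_cosh_eq (μ t : ℝ) : Real.cosh t * Real.cosh (μ * t) =
    (Real.cosh ((μ + 1) * t) + Real.cosh ((μ - 1) * t)) / 2 := by
  rw [add_mul, sub_mul, Real.cosh_add, Real.cosh_sub, one_mul]; ring

theorem integrableOn_besselK_mul_cosh {z : ℝ} (hz : 0 < z) (μ : ℝ) :
    IntegrableOn (fun t => Real.exp (-z * Real.cosh t) * (Real.cosh t * Real.cosh (μ * t)))
      (Set.Ioi 0) := by
  have := ((integrableOn_besselK hz (μ + 1)).add (integrableOn_besselK hz (μ - 1))).div_const 2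
  refine this.congr (ae_of_all _ fun t => ?_)
  simp only [cosh_mul_cosh_eq, Pi.add_apply]; ring

theorem integral_besselK_mul_cosh {z : ℝ} (hz : 0 < z) (μ : ℝ) :
    ∫ t in Set.Ioi (0 : ℝ), Real.exp (-z * Real.cosh t) * (Real.cosh t * Real.cosh (μ * t)) =
      (besselK (μ + 1) z + besselK (μ - 1) z) / 2 := by
  unfold besselK
  rw [← integral_add (integrableOn_besselK hz _) (integrableOn_besselK hz _), ← integral_div]
  congr 1; ext t
  rw [cosh_mul_cosh_eq]; ring

theorem hasDerivAt_besselK {z : ℝ} (hz : 0 < z) (μ : ℝ) :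
    HasDerivAt (besselK μ) (-((besselK (μ + 1) z + besselK (μ - 1) z) / 2)) z := by
  have key := hasDerivAt_integral_of_dominated_loc_of_deriv_le
    (μ := volume.restrict (Set.Ioi (0 : ℝ))) (x₀ := z) (s := Set.Ioi (z / 2))
    (F := fun x t => Real.exp (-x * Real.cosh t) * Real.cosh (μ * t))
    (F' := fun x t => -(Real.exp (-x * Real.cosh t) * (Real.cosh t * Real.cosh (μ * t))))
    (bound := fun t => Real.exp (-(z / 2) * Real.cosh t) * (Real.cosh t * Real.cosh (μ * t)))
    (Ioi_mem_nhds (by linarith)) (Eventually.of_forall fun x => by fun_prop)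
    (integrableOn_besselK hz μ) (by fun_prop)
    (ae_of_all _ fun t x hx => ?_) (integrableOn_besselK_mul_cosh (half_pos hz) μ)
    (ae_of_all _ fun t x hx => ?_)
  · have := key.2
    rw [integral_neg, integral_besselK_mul_cosh hz] at this
    exact this
  · have h1 := Real.cosh_pos t
    have h2 := Real.cosh_pos (μ * t)
    rw [norm_neg, Real.norm_of_nonneg (by positivity)]
    have : z / 2 < x := hx
    gcongr
  · have := (((hasDerivAt_id x).neg.mul_const (Real.cosh t)).exp).mul_const (Real.cosh (μ * t))
    refine this.congr_deriv ?_
    simp; ring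

theorem besselK_pos {z : ℝ} (hz : 0 < z) (μ : ℝ) : 0 < besselK μ z := by
  unfold besselK
  rw [setIntegral_pos_iff_support_of_nonneg_ae (ae_of_all _ fun t => by
    change 0 ≤ Real.exp (-z * Real.cosh t) * Real.cosh (μ * t)
    positivity) (integrableOn_besselK hz μ)]
  have : Function.support (fun t => Real.exp (-z * Real.cosh t) * Real.cosh (μ * t))
      = Set.univ := by
    ext t
    simp [(Real.cosh_pos (μ * t)).ne']
  rw [this]
  simp

theorem besselK_le_besselK {z : ℝ} (hz : 0 < z) {μ ν : ℝ} (h : |μ| ≤ |ν|) :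
    besselK μ z ≤ besselK ν z := by
  unfold besselK
  refine integral_mono (integrableOn_besselK hz μ) (integrableOn_besselK hz ν) fun t => ?_
  have : Real.cosh (μ * t) ≤ Real.cosh (ν * t) := by
    rw [Real.cosh_le_cosh, abs_mul, abs_mul]; gcongr
  dsimp only
  gcongr

theorem besselK_recurrence {z : ℝ} (hz : 0 < z) (μ : ℝ) :
    z * (besselK (μ + 1) z - besselK (μ - 1) z) = 2 * μ * besselK μ z := by
  have hd : ∀ t ∈ Set.Ici (0 : ℝ), HasDerivAt
      (fun t => Real.exp (-z * Real.cosh t) * Real.sinh (μ * t))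
      (μ * (Real.exp (-z * Real.cosh t) * Real.cosh (μ * t)) -
        z / 2 * (Real.exp (-z * Real.cosh t) * Real.cosh ((μ + 1) * t)
        - Real.exp (-z * Real.cosh t) * Real.cosh ((μ - 1) * t))) t := by
    intro t _
    have h := (((Real.hasDerivAt_cosh t).const_mul (-z)).exp).mul
      (((hasDerivAt_id t).const_mul μ).sinh)
    refine h.congr_deriv ?_
    rw [add_mul, sub_mul, Real.cosh_add, Real.cosh_sub, one_mul]
    simp; ring
  have i0 := (integrableOn_besselK hz μ).const_mul μ
  have i1 := ((integrableOn_besselK hz (μ + 1)).sub (integrableOn_besselK hz (μ - 1))).const_mul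
    (z / 2)
  have hlim : Tendsto (fun t => Real.exp (-z * Real.cosh t) * Real.sinh (μ * t)) atTop (nhds 0) := by
    have hb : Tendsto (fun t : ℝ => Real.exp ((|μ| + 1) ^ 2 / (2 * z)) * Real.exp (-1 * t)) atTop
        (nhds 0) := by
      simpa using (Real.tendsto_exp_neg_atTop_nhds_zero).const_mul
        (Real.exp ((|μ| + 1) ^ 2 / (2 * z)))
    refine squeeze_zero_norm' ?_ hb
    filter_upwards [eventually_ge_atTop 0] with t ht
    refine le_trans ?_ (exp_neg_mul_cosh_mul_cosh_le hz μ ht)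
    rw [norm_mul, Real.norm_of_nonneg (Real.exp_pos _).le, Real.norm_eq_abs]
    gcongr
    rw [← Real.cosh_abs, Real.abs_sinh]
    exact (Real.sinh_lt_cosh _).le
  have h := integral_Ioi_of_hasDerivAt_of_tendsto' hd (i0.sub i1) hlim
  erw [integral_sub i0 i1] at h
  simp only [Pi.sub_apply] at h
  rw [ integral_const_mul, integral_const_mul,
    integral_sub (integrableOn_besselK hz _) (integrableOn_besselK hz _)] at h
  simp only [mul_zero, Real.sinh_zero, sub_zero] at h
  unfold besselK
  linarith

theorem Hfun_eq (d : ℤ) {z : ℝ} (hz : 0 < z) {ν : ℝ} (hν : ν = ((d : ℝ) + 1) / 2) :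
    Hfun d z = z ^ 2 * ((besselK (ν + 1 + 1) z + besselK ν z) / 2 * besselK ν z -
      besselK (ν + 1) z * ((besselK (ν + 1) z + besselK (ν - 1) z) / 2)) / besselK ν z ^ 2 := by
  have h0 := hasDerivAt_besselK hz ν
  have h1 := hasDerivAt_besselK hz (ν + 1)
  have hG : G d 1 = fun x => besselK (ν + 1) x / besselK ν x := by
    ext x; simp [G, hν]
  have h := (h1.fun_div h0 (besselK_pos hz ν).ne').deriv
  rw [Hfun, hG, h, add_sub_cancel_right]
  ring

theorem tendsto_Hfun_zero (d : ℤ) (hd : 2 ≤ d) :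
    Tendsto (Hfun d) (nhdsWithin 0 (Set.Ioi 0)) (nhds ((d : ℝ) + 1)) := by
  obtain ⟨ν, hν⟩ : ∃ ν : ℝ, ν = ((d : ℝ) + 1) / 2 := ⟨_, rfl⟩
  have hd' : (2 : ℝ) ≤ d := by exact_mod_cast hd
  have hz0 : Tendsto (fun z : ℝ => z) (nhdsWithin 0 (Set.Ioi 0)) (nhds 0) :=
    tendsto_nhdsWithin_of_tendsto_nhds tendsto_id
  have hr : Tendsto (fun z => z * (besselK (ν - 1) z / besselK ν z)) (nhdsWithin 0 (Set.Ioi 0))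
      (nhds 0) := by
    refine squeeze_zero' ?_ ?_ hz0
    · filter_upwards [self_mem_nhdsWithin] with z hz
      have hz : 0 < z := hz
      have := besselK_pos hz ν
      have := besselK_pos hz (ν - 1)
      positivity
    · filter_upwards [self_mem_nhdsWithin] with z hz
      have hz : 0 < z := hz
      have h1 : besselK (ν - 1) z / besselK ν z ≤ 1 := by
        rw [div_le_one (besselK_pos hz ν)]
        apply besselK_le_besselK hz
        rw [abs_of_nonneg (by linarith), abs_of_nonneg (by linarith)]
        linarith
      nlinarith
  have hF : Tendsto (fun z => z ^ 2 + (2 * ν + 1) * (2 * ν + z * (besselK (ν - 1) z / besselK ν z))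
      - (2 * ν + z * (besselK (ν - 1) z / besselK ν z)) ^ 2) (nhdsWithin 0 (Set.Ioi 0))
      (nhds (0 ^ 2 + (2 * ν + 1) * (2 * ν + 0) - (2 * ν + 0) ^ 2)) :=
    ((hz0.pow 2).add ((hr.const_add _).const_mul _)).sub ((hr.const_add _).pow 2)
  have hL : (0 ^ 2 + (2 * ν + 1) * (2 * ν + 0) - (2 * ν + 0) ^ 2) = (d : ℝ) + 1 := by
    rw [hν]; ring
  rw [hL] at hF
  refine hF.congr' ?_
  filter_upwards [self_mem_nhdsWithin] with z hz
  have hz : 0 < z := hz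
  have hK := besselK_pos hz ν
  rw [Hfun_eq d hz hν]
  have r0 := besselK_recurrence hz ν
  have r1 := besselK_recurrence hz (ν + 1)
  rw [add_sub_cancel_right] at r1
  have e0 : besselK (ν + 1) z = besselK (ν - 1) z + 2 * ν * besselK ν z / z := by
    field_simp; linarith
  have e1 : besselK (ν + 1 + 1) z = besselK ν z + 2 * (ν + 1) * besselK (ν + 1) z / z := by
    field_simp; linarith
  rw [e1, e0]
  field_simp
  ring

theorem tendsto_laplace (m : ℕ) {g : ℝ → ℝ} (hg : Continuous g) {A C L : ℝ} (hA : 0 ≤ A)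
    (hbd : ∀ t, 0 < t → |g t| ≤ C * t ^ (2 * m) * Real.exp (A * t))
    (hlim : Tendsto (fun t => g t / t ^ (2 * m)) (nhdsWithin 0 (Set.Ioi 0)) (nhds L)) :
    Tendsto (fun r : ℝ => r ^ (2 * m + 1) *
      ∫ t in Set.Ioi (0 : ℝ), Real.exp (-r ^ 2 * (Real.cosh t - 1)) * g t) atTop
      (nhds (L * ∫ s in Set.Ioi (0 : ℝ), s ^ (2 * m) * Real.exp (-(s ^ 2 / 2)))) := by
  have hC : 0 ≤ C := by
    have := (abs_nonneg _).trans (hbd 1 one_pos)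
    simp only [one_pow, mul_one] at this
    exact nonneg_of_mul_nonneg_left this (Real.exp_pos _)
  have hscale : ∀ s : ℝ, 0 < s →
      Tendsto (fun r : ℝ => r⁻¹ * s) atTop (nhdsWithin 0 (Set.Ioi 0)) := by
    intro s hs
    refine tendsto_nhdsWithin_iff.2 ⟨by simpa using tendsto_inv_atTop_zero.mul_const s, ?_⟩
    filter_upwards [eventually_gt_atTop 0] with r hr
    exact mul_pos (inv_pos.2 hr) hs
  have key : Tendsto (fun r : ℝ => ∫ s in Set.Ioi (0 : ℝ), r ^ (2 * m) *
      (Real.exp (-r ^ 2 * (Real.cosh (r⁻¹ * s) - 1)) * g (r⁻¹ * s))) atTop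
      (nhds (∫ s in Set.Ioi (0 : ℝ), L * (s ^ (2 * m) * Real.exp (-(s ^ 2 / 2))))) := by
    refine tendsto_integral_filter_of_dominated_convergence
      (fun s => C * (2 * m).factorial * Real.exp ((A + 2) ^ 2 / 2) * Real.exp (-1 * s))
      (Eventually.of_forall fun r => by fun_prop) ?_
      ((exp_neg_integrableOn_Ioi 0 one_pos).const_mul _) ?_
    · filter_upwards [eventually_ge_atTop 1] with r hr
      refine (ae_restrict_iff' measurableSet_Ioi).2 (ae_of_all _ fun s hs => ?_)
      have hs : 0 < s := hs
      have hr0 : 0 < r := by linarith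
      have h1 : |g (r⁻¹ * s)| ≤ C * (r⁻¹ * s) ^ (2 * m) * Real.exp (A * s) := by
        refine (hbd _ (by positivity)).trans ?_
        gcongr
        have : r⁻¹ ≤ 1 := inv_le_one_of_one_le₀ hr
        nlinarith
      have h2 : Real.exp (-r ^ 2 * (Real.cosh (r⁻¹ * s) - 1)) ≤ Real.exp (-(s ^ 2 / 2)) := by
        apply Real.exp_le_exp.2
        have := mul_le_mul_of_nonneg_left (sq_div_two_le_cosh_sub_one (r⁻¹ * s)) (sq_nonneg r)
        have e : r ^ 2 * ((r⁻¹ * s) ^ 2 / 2) = s ^ 2 / 2 := by field_simp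
        linarith
      have h3 : s ^ (2 * m) ≤ (2 * m).factorial * Real.exp s := by
        have := Real.pow_div_factorial_le_exp s hs.le (2 * m)
        rwa [div_le_iff₀' (by positivity)] at this
      rw [norm_mul, norm_mul, Real.norm_of_nonneg (by positivity), Real.norm_of_nonneg
        (Real.exp_pos _).le, Real.norm_eq_abs]
      calc _ ≤ r ^ (2 * m) * (Real.exp (-(s ^ 2 / 2)) *
            (C * (r⁻¹ * s) ^ (2 * m) * Real.exp (A * s))) := by gcongr
        _ = C * s ^ (2 * m) * (Real.exp (-(s ^ 2 / 2)) * Real.exp (A * s)) := by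
            rw [mul_pow, inv_pow]; field_simp
        _ ≤ C * ((2 * m).factorial * Real.exp s) *
            (Real.exp (-(s ^ 2 / 2)) * Real.exp (A * s)) := by gcongr
        _ = C * (2 * m).factorial * Real.exp (s + (-(s ^ 2 / 2) + A * s)) := by
            rw [Real.exp_add s, Real.exp_add]; ring
        _ ≤ C * (2 * m).factorial * Real.exp ((A + 2) ^ 2 / 2 + -1 * s) := by
            refine mul_le_mul_of_nonneg_left (Real.exp_le_exp.2 ?_) (by positivity)
            nlinarith [sq_nonneg (A + 2 - s)]
        _ = _ := by rw [Real.exp_add]; ring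
    · refine (ae_restrict_iff' measurableSet_Ioi).2 (ae_of_all _ fun s hs => ?_)
      have hs : 0 < s := hs
      have l1 := hlim.comp (hscale s hs)
      have l2 := (tendsto_sinh_mul_div (1 / 2)).comp (hscale s hs)
      have l3 := ((((l2.pow 2).const_mul (-(2 * s ^ 2))).rexp).const_mul (s ^ (2 * m))).mul l1
      have e : s ^ (2 * m) * Real.exp (-(2 * s ^ 2) * (1 / 2) ^ 2) * L =
          L * (s ^ (2 * m) * Real.exp (-(s ^ 2 / 2))) := by
        rw [show -(2 * s ^ 2) * (1 / 2) ^ 2 = -(s ^ 2 / 2) by ring]; ring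
      rw [e] at l3
      refine l3.congr' ?_
      filter_upwards [eventually_gt_atTop 0] with r hr
      have e2 : -(2 * s ^ 2) * (Real.sinh (1 / 2 * (r⁻¹ * s)) / (r⁻¹ * s)) ^ 2 =
          -r ^ 2 * (Real.cosh (r⁻¹ * s) - 1) := by
        rw [cosh_sub_one_eq, show 1 / 2 * (r⁻¹ * s) = r⁻¹ * s / 2 by ring]
        field_simp
      simp only [Function.comp_apply]
      rw [e2, mul_pow, inv_pow]
      field_simp
  rw [integral_const_mul] at key
  refine key.congr' ?_
  filter_upwards [eventually_gt_atTop 0] with r hr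
  rw [integral_const_mul, integral_comp_mul_left_Ioi
    (fun t => Real.exp (-r ^ 2 * (Real.cosh t - 1)) * g t) 0 (inv_pos.2 hr)]
  simp only [mul_zero, inv_inv, smul_eq_mul]
  ring

theorem integral_pow_mul_exp_neg_sq_div_two (m : ℕ) :
    ∫ s in Set.Ioi (0 : ℝ), s ^ (2 * m) * Real.exp (-(s ^ 2 / 2)) =
      (1 / 2 : ℝ) ^ (-(1 / 2 : ℝ)) * 2 ^ m / 2 * Real.Gamma (m + 1 / 2) := by
  have h := integral_rpow_mul_exp_neg_mul_rpow (p := 2) (q := (2 * m : ℕ)) (b := 1 / 2)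
    two_pos (by have : (0 : ℝ) ≤ (2 * m : ℕ) := Nat.cast_nonneg _
                linarith) (by norm_num)
  have e : (1 / 2 : ℝ) ^ (-(((2 * m : ℕ) : ℝ) + 1) / 2) = (1 / 2 : ℝ) ^ (-(1 / 2 : ℝ)) * 2 ^ m := by
    rw [show -(((2 * m : ℕ) : ℝ) + 1) / 2 = -(1 / 2 : ℝ) + -(m : ℝ) by push_cast; ring,
      Real.rpow_add (by norm_num), Real.rpow_neg (by norm_num) (m : ℝ), Real.rpow_natCast]
    simp
  rw [e, show (((2 * m : ℕ) : ℝ) + 1) / 2 = m + 1 / 2 by push_cast; ring] at h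
  rw [mul_div_assoc, ← mul_one_div (2 ^ m : ℝ) 2, ← mul_assoc, ← h]
  refine setIntegral_congr_fun measurableSet_Ioi fun s _ => ?_
  simp only [Real.rpow_natCast, Real.rpow_ofNat]
  ring_nf

theorem exp_mul_integral_besselK (z : ℝ) (f : ℝ → ℝ) :
    ∫ t in Set.Ioi (0 : ℝ), Real.exp (-z * (Real.cosh t - 1)) * f t =
      Real.exp z * ∫ t in Set.Ioi (0 : ℝ), Real.exp (-z * Real.cosh t) * f t := by
  rw [← integral_const_mul]
  congr 1; ext t
  rw [← mul_assoc, ← Real.exp_add]; ring_nf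

theorem exp_mul_besselK_second_difference {z : ℝ} (hz : 0 < z) (μ : ℝ) :
    Real.exp z * ((besselK (μ + 1) z + besselK (μ - 1) z) / 2 - besselK μ z) =
      ∫ t in Set.Ioi (0 : ℝ), Real.exp (-z * (Real.cosh t - 1)) *
        ((Real.cosh t - 1) * Real.cosh (μ * t)) := by
  rw [exp_mul_integral_besselK, ← integral_besselK_mul_cosh hz, besselK,
    ← integral_sub (integrableOn_besselK_mul_cosh hz μ) (integrableOn_besselK hz μ)]
  congr 2; ext t; ring

theorem integrableOn_second_difference {z : ℝ} (hz : 0 < z) (μ : ℝ) :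
    IntegrableOn (fun t => Real.exp (-z * Real.cosh t) * ((Real.cosh t - 1) * Real.cosh (μ * t)))
      (Set.Ioi 0) := by
  refine ((integrableOn_besselK_mul_cosh hz μ).sub (integrableOn_besselK hz μ)).congr
    (ae_of_all _ fun t => ?_)
  simp only [Pi.sub_apply]; ring

theorem exp_mul_besselK_difference {z : ℝ} (hz : 0 < z) (μ : ℝ) :
    Real.exp z * (besselK (μ + 1) z - besselK μ z) =
      ∫ t in Set.Ioi (0 : ℝ), Real.exp (-z * (Real.cosh t - 1)) *
        (Real.cosh ((μ + 1) * t) - Real.cosh (μ * t)) := by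
  rw [exp_mul_integral_besselK, besselK, besselK,
    ← integral_sub (integrableOn_besselK hz _) (integrableOn_besselK hz _)]
  congr 2; ext t; ring

theorem exp_mul_besselK_third_difference {z : ℝ} (hz : 0 < z) (μ : ℝ) :
    Real.exp z * (((besselK (μ + 1 + 1) z + besselK μ z) / 2 - besselK (μ + 1) z) -
        ((besselK (μ + 1) z + besselK (μ - 1) z) / 2 - besselK μ z)) =
      ∫ t in Set.Ioi (0 : ℝ), Real.exp (-z * (Real.cosh t - 1)) *
        ((Real.cosh t - 1) * (Real.cosh ((μ + 1) * t) - Real.cosh (μ * t))) := by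
  have h := exp_mul_besselK_second_difference hz (μ + 1)
  rw [add_sub_cancel_right] at h
  rw [mul_sub, h, exp_mul_besselK_second_difference hz, exp_mul_integral_besselK,
    exp_mul_integral_besselK, exp_mul_integral_besselK, ← mul_sub,
    ← integral_sub (integrableOn_second_difference hz _) (integrableOn_second_difference hz _)]
  congr 2; ext t; ring

theorem cosh_add_one_mul_sub_cosh (μ t : ℝ) : Real.cosh ((μ + 1) * t) - Real.cosh (μ * t) =
    2 * Real.sinh ((μ + 1 / 2) * t) * Real.sinh (t / 2) := by
  rw [show (μ + 1) * t = (μ + 1 / 2) * t + t / 2 by ring,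
    show μ * t = (μ + 1 / 2) * t - t / 2 by ring, Real.cosh_add, Real.cosh_sub]
  ring

theorem tendsto_cosh_mul_zero (a : ℝ) :
    Tendsto (fun t : ℝ => Real.cosh (a * t)) (nhdsWithin 0 (Set.Ioi 0)) (nhds 1) := by
  refine tendsto_nhdsWithin_of_tendsto_nhds ?_
  have : Continuous fun t : ℝ => Real.cosh (a * t) := by fun_prop
  simpa using this.tendsto 0

theorem tendsto_Hfun_atTop (d : ℤ) (hd : 2 ≤ d) :
    Tendsto (Hfun d) atTop (nhds ((d : ℝ) / 2 + 1)) := by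
  obtain ⟨ν, hν⟩ : ∃ ν : ℝ, ν = ((d : ℝ) + 1) / 2 := ⟨_, rfl⟩
  have hd' : (2 : ℝ) ≤ d := by exact_mod_cast hd
  have hν0 : 0 < ν := by linarith
  have hS := tendsto_sinh_mul_div (ν + 1 / 2)
  have hs := tendsto_sinh_mul_div (1 / 2)
  have hc := tendsto_cosh_mul_zero ν
  have bc : ∀ t : ℝ, 0 < t → Real.cosh (ν * t) ≤ Real.exp (ν * t) := fun t ht => by
    simpa [abs_of_pos hν0, abs_of_pos ht] using cosh_le_exp_abs (ν * t)
  have bs : ∀ t : ℝ, Real.sinh (t / 2) ≤ t / 2 * Real.exp (t / 2) := fun t =>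
    sinh_le_self_mul_exp _
  have bS : ∀ t : ℝ, Real.sinh ((ν + 1 / 2) * t) ≤
      (ν + 1 / 2) * t * Real.exp ((ν + 1 / 2) * t) := fun t => sinh_le_self_mul_exp _
  have ps : ∀ t : ℝ, 0 < t → 0 < Real.sinh (t / 2) := fun t ht =>
    Real.sinh_pos_iff.2 (by linarith)
  have pS : ∀ t : ℝ, 0 < t → 0 < Real.sinh ((ν + 1 / 2) * t) := fun t ht =>
    Real.sinh_pos_iff.2 (by positivity)
  have half : ∀ t : ℝ, 1 / 2 * t = t / 2 := fun t => by ring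
  simp only [half] at hs
  have T0 := tendsto_laplace 0 (g := fun t => Real.cosh (ν * t)) (by fun_prop) (A := ν) (C := 1)
    (L := 1) hν0.le (fun t ht => by
      rw [abs_of_pos (Real.cosh_pos _)]
      simpa using bc t ht) (by simpa using hc)
  have TA := tendsto_laplace 1 (g := fun t => (Real.cosh t - 1) * Real.cosh (ν * t)) (by fun_prop)
    (A := ν + 1) (C := 1 / 2) (L := 1 / 2) (by positivity) (fun t ht => by
      have := ps t ht
      rw [cosh_sub_one_eq, abs_of_nonneg (by positivity)]
      calc _ ≤ 2 * (t / 2 * Real.exp (t / 2)) ^ 2 * Real.exp (ν * t) := by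
            gcongr
            exacts [bs t, bc t ht]
        _ = 1 / 2 * t ^ (2 * 1) * Real.exp (t / 2 + t / 2 + ν * t) := by
            rw [Real.exp_add, Real.exp_add]; ring
        _ = _ := by ring_nf) (by
      have h := ((hs.pow 2).const_mul 2).mul hc
      refine (h.congr' ?_).trans (le_of_eq (by norm_num))
      filter_upwards [self_mem_nhdsWithin] with t ht
      have ht : 0 < t := ht
      rw [cosh_sub_one_eq]
      field_simp)
  have TB := tendsto_laplace 1 (g := fun t => Real.cosh ((ν + 1) * t) - Real.cosh (ν * t))
    (by fun_prop) (A := ν + 1) (C := ν + 1 / 2) (L := ν + 1 / 2) (by positivity) (fun t ht => by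
      have := ps t ht
      have := pS t ht
      rw [cosh_add_one_mul_sub_cosh, abs_of_nonneg (by positivity)]
      calc _ ≤ 2 * ((ν + 1 / 2) * t * Real.exp ((ν + 1 / 2) * t)) * (t / 2 * Real.exp (t / 2)) := by
            gcongr
            exacts [bS t, bs t]
        _ = (ν + 1 / 2) * t ^ (2 * 1) * Real.exp ((ν + 1 / 2) * t + t / 2) := by
            rw [Real.exp_add]; ring
        _ = _ := by ring_nf) (by
      have h := (hS.const_mul 2).mul hs
      refine (h.congr' ?_).trans (le_of_eq (by ring_nf))
      filter_upwards [self_mem_nhdsWithin] with t ht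
      have ht : 0 < t := ht
      rw [cosh_add_one_mul_sub_cosh]
      field_simp)
  have TC := tendsto_laplace 2
    (g := fun t => (Real.cosh t - 1) * (Real.cosh ((ν + 1) * t) - Real.cosh (ν * t)))
    (by fun_prop) (A := ν + 2) (C := (ν + 1 / 2) / 2) (L := (ν + 1 / 2) / 2) (by positivity)
    (fun t ht => by
      have := ps t ht
      have := pS t ht
      rw [cosh_sub_one_eq, cosh_add_one_mul_sub_cosh, abs_of_nonneg (by positivity)]
      calc _ ≤ 2 * (t / 2 * Real.exp (t / 2)) ^ 2 *
            (2 * ((ν + 1 / 2) * t * Real.exp ((ν + 1 / 2) * t)) * (t / 2 * Real.exp (t / 2))) := by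
            gcongr
            exacts [bs t, bS t, bs t]
        _ = (ν + 1 / 2) / 2 * t ^ (2 * 2) *
            Real.exp (t / 2 + t / 2 + (ν + 1 / 2) * t + t / 2) := by
            rw [Real.exp_add, Real.exp_add, Real.exp_add]; ring
        _ = _ := by ring_nf) (by
      have h := ((hs.pow 2).const_mul 2).mul ((hS.const_mul 2).mul hs)
      refine (h.congr' ?_).trans (le_of_eq (by ring_nf))
      filter_upwards [self_mem_nhdsWithin] with t ht
      have ht : 0 < t := ht
      rw [cosh_sub_one_eq, cosh_add_one_mul_sub_cosh]
      field_simp)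
  have J1 : ∫ s in Set.Ioi (0 : ℝ), s ^ (2 * 1) * Real.exp (-(s ^ 2 / 2)) =
      ∫ s in Set.Ioi (0 : ℝ), s ^ (2 * 0) * Real.exp (-(s ^ 2 / 2)) := by
    rw [integral_pow_mul_exp_neg_sq_div_two, integral_pow_mul_exp_neg_sq_div_two]
    have := Real.Gamma_add_one (s := 1 / 2) (by norm_num)
    norm_num at this ⊢
    rw [this]; ring
  have J2 : ∫ s in Set.Ioi (0 : ℝ), s ^ (2 * 2) * Real.exp (-(s ^ 2 / 2)) =
      3 * ∫ s in Set.Ioi (0 : ℝ), s ^ (2 * 0) * Real.exp (-(s ^ 2 / 2)) := by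
    rw [integral_pow_mul_exp_neg_sq_div_two, integral_pow_mul_exp_neg_sq_div_two]
    have h1 := Real.Gamma_add_one (s := 1 / 2) (by norm_num)
    have h2 := Real.Gamma_add_one (s := 1 / 2 + 1) (by norm_num)
    norm_num at h1 h2 ⊢
    rw [h2, h1]; ring
  have J0 : 0 < ∫ s in Set.Ioi (0 : ℝ), s ^ (2 * 0) * Real.exp (-(s ^ 2 / 2)) := by
    rw [integral_pow_mul_exp_neg_sq_div_two]
    have := Real.Gamma_pos_of_pos (s := ((0 : ℕ) : ℝ) + 1 / 2) (by norm_num)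
    positivity
  rw [J1] at TA TB
  rw [J2] at TC
  set J := ∫ s in Set.Ioi (0 : ℝ), s ^ (2 * 0) * Real.exp (-(s ^ 2 / 2))
  have T := ((TC.mul T0).sub (TA.mul TB)).div (T0.pow 2) (by positivity)
  have eL : ((ν + 1 / 2) / 2 * (3 * J) * (1 * J) - 1 / 2 * J * ((ν + 1 / 2) * J)) / (1 * J) ^ 2
      = (d : ℝ) / 2 + 1 := by
    rw [hν]; field_simp; ring
  rw [eL] at T
  refine (T.comp tendsto_sqrt_atTop).congr' ?_
  filter_upwards [eventually_gt_atTop 0] with z hz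
  have hK := besselK_pos hz ν
  have hr : 0 < √z := Real.sqrt_pos.2 hz
  have hI0 : ∫ t in Set.Ioi (0 : ℝ), Real.exp (-z * (Real.cosh t - 1)) * Real.cosh (ν * t) =
      Real.exp z * besselK ν z := exp_mul_integral_besselK z _
  have hr2 := Real.sq_sqrt hz.le
  simp only [Function.comp_apply, Pi.div_apply, hr2]
  rw [hI0, ← exp_mul_besselK_second_difference hz, ← exp_mul_besselK_difference hz,
    ← exp_mul_besselK_third_difference hz, Hfun_eq d hz hν]
  have hE := Real.exp_pos z
  rw [show z ^ 2 = √z ^ 4 by rw [← hr2]; simp only [hr2]; nlinarith]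
  field_simp
  ring

/-- Limits of the heat capacity: `H(z) → d + 1` as `z → 0⁺` (i.e. `T → ∞`) and
`H(z) → d/2 + 1` as `z → ∞` (i.e. `T → 0`). -/
theorem Hfun_limits (d : ℤ) (hd : 2 ≤ d) :
    Tendsto (Hfun d) (nhdsWithin 0 (Set.Ioi 0)) (nhds ((d : ℝ) + 1)) ∧
    Tendsto (Hfun d) atTop (nhds ((d : ℝ) / 2 + 1)) := by
  exact ⟨tendsto_Hfun_zero d hd, tendsto_Hfun_atTop d hd⟩
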